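/- Fix an integer C ≥ 1 and let g(λ) = Σ_{k=0}^C λ^k/k!. The function h(λ) = λ g′(λ)/g(λ) is strictly increasing on (0,∞) and maps (0,∞) bijectively onto (0,C); consequently, for every ρ ∈ (0,C) the equation λ g′(λ)/g(λ) = ρ has a unique positive solution. Moreover h(λ) = E[W(λ)], the mean of the truncated Poisson random variable W(λ). -/

import Mathlib

open Filter Finset
open scoped BigOperators

/-- `g(λ) = ∑_{k=0}^C λ^k / k!`. -/
noncomputable def gfun (C : ℕ) (x : ℝ) : ℝ :=
  ∑ k ∈ Finset.range (C + 1), x ^ k / (Nat.factorial k)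

/-- Mean of the truncated Poisson random variable `W(λ)`,
`E W(λ) = ∑_{j=0}^C j · λ^j/(j! g(λ))`. -/
noncomputable def meanW (C : ℕ) (x : ℝ) : ℝ :=
  ∑ j ∈ Finset.range (C + 1), (j : ℝ) * (x ^ j / (Nat.factorial j * gfun C x))

theorem mul_deriv_gfun (C : ℕ) (x : ℝ) :
    x * deriv (gfun C) x = ∑ k ∈ Finset.range (C + 1), (k : ℝ) * (x ^ k / Nat.factorial k) := by
  have hd : HasDerivAt (gfun C)
      (∑ k ∈ Finset.range (C + 1), (k : ℝ) * x ^ (k - 1) / Nat.factorial k) x :=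
    HasDerivAt.fun_sum fun k _ => (hasDerivAt_pow k x).div_const _
  rw [hd.deriv, Finset.mul_sum]
  refine Finset.sum_congr rfl fun k _ => ?_
  rcases k with _ | k
  · simp
  · rw [Nat.add_sub_cancel, pow_succ]
    ring

theorem pow_div_factorial_le_gfun {C k : ℕ} (hk : k ≤ C) {x : ℝ} (hx : 0 ≤ x) :
    x ^ k / Nat.factorial k ≤ gfun C x :=
  Finset.single_le_sum (f := fun k : ℕ => x ^ k / (Nat.factorial k : ℝ))
    (fun _ _ => by positivity) (Finset.mem_range.2 (Nat.lt_succ_of_le hk))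

theorem gfun_pos (C : ℕ) {x : ℝ} (hx : 0 ≤ x) : 0 < gfun C x :=
  lt_of_lt_of_le (by simp) (pow_div_factorial_le_gfun (Nat.zero_le C) hx)

theorem continuous_gfun (C : ℕ) : Continuous (gfun C) := by
  unfold gfun
  fun_prop

theorem mul_deriv_gfun_div_eq_meanW (C : ℕ) (x : ℝ) :
    x * deriv (gfun C) x / gfun C x = meanW C x := by
  rw [mul_deriv_gfun, meanW, Finset.sum_div]
  refine Finset.sum_congr rfl fun k _ => ?_
  rw [mul_div_assoc, div_div]

theorem meanW_eq_div (C : ℕ) (x : ℝ) :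
    meanW C x =
      (∑ k ∈ Finset.range (C + 1), (k : ℝ) * (x ^ k / Nat.factorial k)) / gfun C x := by
  rw [← mul_deriv_gfun_div_eq_meanW, mul_deriv_gfun]

theorem meanW_zero (C : ℕ) : meanW C 0 = 0 := by
  rw [← mul_deriv_gfun_div_eq_meanW, zero_mul, zero_div]

theorem continuousOn_meanW (C : ℕ) : ContinuousOn (meanW C) (Set.Ici 0) := by
  rw [funext (meanW_eq_div C)]
  exact ContinuousOn.div (by fun_prop) (continuous_gfun C).continuousOn
    fun x hx => (gfun_pos C hx).ne'

/-- The distance from the mean to the right end point of the support. -/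
theorem sub_meanW (C : ℕ) {x : ℝ} (hx : 0 ≤ x) :
    C - meanW C x =
      (∑ k ∈ Finset.range (C + 1), ((C : ℝ) - k) * (x ^ k / Nat.factorial k)) / gfun C x := by
  rw [meanW_eq_div, eq_div_iff (gfun_pos C hx).ne', sub_mul, div_mul_cancel₀ _ (gfun_pos C hx).ne',
    gfun, Finset.mul_sum, ← Finset.sum_sub_distrib]
  exact Finset.sum_congr rfl fun k _ => (sub_mul _ _ _).symm

theorem meanW_pos {C : ℕ} (hC : 1 ≤ C) {x : ℝ} (hx : 0 < x) : 0 < meanW C x := by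
  rw [meanW_eq_div]
  refine div_pos (Finset.sum_pos' (fun k _ => by positivity) ⟨1, ?_, ?_⟩) (gfun_pos C hx.le)
  · simpa using Nat.succ_le_iff.1 hC
  · simpa using hx

theorem meanW_lt {C : ℕ} (hC : 1 ≤ C) {x : ℝ} (hx : 0 ≤ x) : meanW C x < C := by
  rw [← sub_pos, sub_meanW C hx]
  refine div_pos (Finset.sum_pos' (fun k hk => ?_) ⟨0, by simp, ?_⟩) (gfun_pos C hx)
  · have : (k : ℝ) ≤ C := Nat.cast_le.2 (Nat.lt_succ_iff.1 (Finset.mem_range.1 hk))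
    exact mul_nonneg (sub_nonneg.2 this) (by positivity)
  · simpa using Nat.succ_le_iff.1 hC

theorem sub_meanW_le (C : ℕ) {x : ℝ} (hx : 1 ≤ x) :
    C - meanW C x ≤ (C + 1) * C * Nat.factorial C / x := by
  have hx0 : 0 < x := by linarith
  have hterm : ∀ k ∈ Finset.range (C + 1),
      ((C : ℝ) - k) * (x ^ k / Nat.factorial k) ≤ C * (x ^ C / x) := by
    intro k hk
    rcases (Nat.lt_succ_iff.1 (Finset.mem_range.1 hk)).eq_or_lt with rfl | hlt
    · rw [sub_self, zero_mul]
      positivity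
    · have hpow : x ^ k / Nat.factorial k ≤ x ^ C / x := by
        calc x ^ k / Nat.factorial k ≤ x ^ k :=
              div_le_self (by positivity) (by exact_mod_cast Nat.factorial_pos k)
          _ ≤ x ^ C / x := by
              rw [le_div_iff₀ hx0, ← pow_succ]
              exact pow_le_pow_right₀ hx hlt
      exact mul_le_mul (sub_le_self _ k.cast_nonneg) hpow (by positivity) C.cast_nonneg
  have hsum := Finset.sum_le_card_nsmul _ _ _ hterm
  rw [Finset.card_range, nsmul_eq_mul, Nat.cast_add_one] at hsum
  rw [sub_meanW C hx0.le, div_le_iff₀ (gfun_pos C hx0.le)]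
  calc _ ≤ ((C : ℝ) + 1) * (C * (x ^ C / x)) := hsum
    _ = (C + 1) * C * Nat.factorial C / x * (x ^ C / Nat.factorial C) := by
        have : (Nat.factorial C : ℝ) ≠ 0 := by positivity
        field_simp
    _ ≤ _ := mul_le_mul_of_nonneg_left (pow_div_factorial_le_gfun le_rfl hx0.le) (by positivity)

theorem sub_mul_pow_mul_pow_sub_nonneg {x y : ℝ} (hx : 0 ≤ x) (hxy : x ≤ y) (i j : ℕ) :
    0 ≤ ((i : ℝ) - j) * (y ^ i * x ^ j - y ^ j * x ^ i) := by
  have key : ∀ {a b : ℕ}, a ≤ b → y ^ a * x ^ b ≤ y ^ b * x ^ a := by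
    intro a b hab
    obtain ⟨d, rfl⟩ := Nat.exists_eq_add_of_le hab
    have hy : 0 ≤ y := hx.trans hxy
    calc y ^ a * x ^ (a + d) = y ^ a * x ^ a * x ^ d := by ring
      _ ≤ y ^ a * x ^ a * y ^ d := by gcongr
      _ = y ^ (a + d) * x ^ a := by ring
  rcases le_total i j with hij | hij
  · exact mul_nonneg_of_nonpos_of_nonpos (sub_nonpos.2 (Nat.cast_le.2 hij)) (sub_nonpos.2 (key hij))
  · exact mul_nonneg (sub_nonneg.2 (Nat.cast_le.2 hij)) (sub_nonneg.2 (key hij))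

theorem strictMonoOn_meanW {C : ℕ} (hC : 1 ≤ C) : StrictMonoOn (meanW C) (Set.Ioi 0) := by
  intro x hx y hy hxy
  rw [Set.mem_Ioi] at hx hy
  rw [meanW_eq_div, meanW_eq_div, div_lt_div_iff₀ (gfun_pos C hx.le) (gfun_pos C hy.le), ← sub_pos]
  set s := Finset.range (C + 1)
  set a : ℝ → ℕ → ℝ := fun z k => z ^ k / Nat.factorial k
  have hdouble : 2 * ((∑ k ∈ s, (k : ℝ) * a y k) * gfun C x
      - (∑ k ∈ s, (k : ℝ) * a x k) * gfun C y)
      = ∑ i ∈ s, ∑ j ∈ s, ((i : ℝ) - j) * (a y i * a x j - a y j * a x i) := by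
    have hg : ∀ z, gfun C z = ∑ k ∈ s, a z k := fun _ => rfl
    have h₁ : ∀ u v : ℝ, (∑ k ∈ s, (k : ℝ) * a u k) * gfun C v
        = ∑ i ∈ s, ∑ j ∈ s, (i : ℝ) * a u i * a v j := fun u v => by
      rw [hg, Finset.sum_mul_sum]
    have h₂ : ∀ u v : ℝ, (∑ k ∈ s, (k : ℝ) * a u k) * gfun C v
        = ∑ i ∈ s, ∑ j ∈ s, (j : ℝ) * a u j * a v i := fun u v => by
      rw [h₁, Finset.sum_comm]
    rw [two_mul]
    nth_rewrite 1 [h₁ y x, h₁ x y]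
    rw [h₂ y x, h₂ x y]
    simp only [← Finset.sum_sub_distrib, ← Finset.sum_add_distrib]
    exact Finset.sum_congr rfl fun i _ => Finset.sum_congr rfl fun j _ => by ring
  have hnonneg : ∀ i j : ℕ, 0 ≤ ((i : ℝ) - j) * (a y i * a x j - a y j * a x i) := by
    intro i j
    have : ((i : ℝ) - j) * (a y i * a x j - a y j * a x i)
        = ((i : ℝ) - j) * (y ^ i * x ^ j - y ^ j * x ^ i)
          / (Nat.factorial i * Nat.factorial j) := by
      simp only [a]
      field_simp
    rw [this]
    exact div_nonneg (sub_mul_pow_mul_pow_sub_nonneg hx.le hxy.le i j) (by positivity)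
  have hpos : 0 < ∑ i ∈ s, ∑ j ∈ s, ((i : ℝ) - j) * (a y i * a x j - a y j * a x i) :=
    Finset.sum_pos' (fun i _ => Finset.sum_nonneg fun j _ => hnonneg i j)
      ⟨1, by simpa [s] using Nat.succ_le_iff.1 hC, Finset.sum_pos' (fun j _ => hnonneg 1 j)
        ⟨0, by simp [s], by simpa [a] using hxy⟩⟩
  linarith

theorem exists_meanW_eq {C : ℕ} {ρ : ℝ} (hρ : 0 < ρ) (hρC : ρ < C) :
    ∃ x, 0 < x ∧ meanW C x = ρ := by
  have hsub : 0 < (C : ℝ) - ρ := sub_pos.2 hρC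
  set K : ℝ := (C + 1) * C * Nat.factorial C
  set b : ℝ := 1 + K / (C - ρ)
  have hK : 0 ≤ K / (C - ρ) := by positivity
  have hb : 1 ≤ b := le_add_of_nonneg_right hK
  have hbρ : ρ ≤ meanW C b := by
    have h₁ : C - meanW C b ≤ K / b := sub_meanW_le C hb
    have h₂ : K / b ≤ C - ρ := by
      rw [div_le_comm₀ (by linarith) hsub]
      exact le_add_of_nonneg_left zero_le_one
    linarith
  obtain ⟨x, hx, rfl⟩ := intermediate_value_Icc (zero_le_one.trans hb)
    ((continuousOn_meanW C).mono Set.Icc_subset_Ici_self) ⟨(meanW_zero C).trans_le hρ.le, hbρ⟩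
  refine ⟨x, hx.1.lt_of_ne ?_, rfl⟩
  rintro rfl
  exact hρ.ne' (meanW_zero C)

/-- **Theorem.** For fixed `C ≥ 1`, the function `h(λ) = λ g'(λ)/g(λ)` is strictly
increasing on `(0,∞)` and maps `(0,∞)` bijectively onto `(0,C)`; consequently, for every
`ρ ∈ (0,C)` the equation `λ g'(λ)/g(λ) = ρ` has a unique positive solution. Moreover
`h(λ) = E[W(λ)]`, the mean of the truncated Poisson random variable `W(λ)`. -/
theorem statement4 (C : ℕ) (hC : 1 ≤ C)
    (h : ℝ → ℝ) (hh : ∀ x, h x = x * deriv (gfun C) x / gfun C x) :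
    StrictMonoOn h (Set.Ioi (0:ℝ)) ∧
    Set.BijOn h (Set.Ioi (0:ℝ)) (Set.Ioo (0:ℝ) C) ∧
    (∀ ρ : ℝ, 0 < ρ → ρ < C → ∃! x : ℝ, 0 < x ∧ h x = ρ) ∧
    (∀ x : ℝ, 0 < x → h x = meanW C x) := by
  obtain rfl : h = meanW C := funext fun x => (hh x).trans (mul_deriv_gfun_div_eq_meanW C x)
  have hmono := strictMonoOn_meanW hC
  refine ⟨hmono, ⟨fun x hx => ⟨meanW_pos hC hx, meanW_lt hC (le_of_lt hx)⟩, hmono.injOn,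
    fun ρ hρ => exists_meanW_eq hρ.1 hρ.2⟩, fun ρ hρ hρC => ?_, fun _ _ => rfl⟩
  obtain ⟨x, hx, hxρ⟩ := exists_meanW_eq hρ hρC
  exact ⟨x, ⟨hx, hxρ⟩, fun y hy => hmono.injOn hy.1 hx (hy.2.trans hxρ.symm)⟩
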